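/- Fix α > 0 and k ≥ 1. For each N ≥ k, let v(N) ∈ ℝ^N be a unit eigenvector of Q_N with eigenvalue λ_k(Q_N), and let ṽ(N) ∈ ℓ²(ℕ) denote v(N) padded with zeros. Then there exist signs ξ_N ∈ {−1, +1} and a vector v ∈ ℓ²(ℕ) with ‖v‖ = 1 such that ξ_N ṽ(N) → v in ℓ²(ℕ) as N → ∞, and v satisfies the recurrence (α n² + 2) v_n − v_{n−1} − v_{n+1} = λ_k v_n for all n ≥ 1 (with v_0 = 0), where λ_k = lim_{N→∞} λ_k(Q_N); that is, v is a unit eigenvector of the odd Jacobi operator B_α^𝒪 with eigenvalue λ_k. -/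

import Mathlib

open Filter

/-- The `N × N` truncation `Q_N = B_α^𝒪(N)` of the odd Jacobi operator: symmetric
tridiagonal, diagonal entries `α k² + 2` (`k = 1, …, N`), off-diagonal entries `-1`. -/
def Qmat (α : ℝ) (N : ℕ) : Matrix (Fin N) (Fin N) ℝ := fun i j =>
  if (i : ℕ) = (j : ℕ) then α * ((i : ℕ) + 1 : ℝ) ^ 2 + 2
  else if (i : ℕ) + 1 = (j : ℕ) ∨ (j : ℕ) + 1 = (i : ℕ) then -1 else 0

/-- `μ` lists the eigenvalues of the real symmetric matrix `M` in nondecreasing order with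
multiplicity. -/
def IsEigSeq {N : ℕ} (M : Matrix (Fin N) (Fin N) ℝ) (μ : Fin N → ℝ) : Prop :=
  Monotone μ ∧ ∃ v : Fin N → (Fin N → ℝ),
    (∀ i j, (∑ t, v i t * v j t) = if i = j then (1 : ℝ) else 0) ∧
    ∀ i, M.mulVec (v i) = μ i • v i

/-- `λ_k(Q_N)` with `1`-based index `k` (junk value `0` when `k > N` or `k = 0`). -/
noncomputable def eigAt (μ : (N : ℕ) → Fin N → ℝ) (k N : ℕ) : ℝ :=
  if h : k - 1 < N then μ N ⟨k - 1, h⟩ else 0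

/-- A vector `(w 1, …, w N) ∈ ℝ^N` padded with zeros to a sequence indexed by `n ∈ ℕ`
(`1`-based entries, with the convention that the `0`-th entry is `0`). -/
def padSeq {N : ℕ} (w : Fin N → ℝ) : ℕ → ℝ := fun n =>
  if h : 1 ≤ n ∧ n ≤ N then w ⟨n - 1, by omega⟩ else 0

/-- The solution of `(α n² + 2) pₙ - pₙ₋₁ - pₙ₊₁ = l pₙ` with `p₀ = 0` and `p₁ = 1`. -/
def jacobiSol (α l : ℝ) : ℕ → ℝ
  | 0 => 0
  | 1 => 1
  | n + 2 => (α * ((n : ℝ) + 1) ^ 2 + 2 - l) * jacobiSol α l (n + 1) - jacobiSol α l n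

theorem jacobiSol_recurrence (α l : ℝ) {n : ℕ} (hn : 1 ≤ n) :
    (α * (n : ℝ) ^ 2 + 2) * jacobiSol α l n - jacobiSol α l (n - 1) - jacobiSol α l (n + 1) =
      l * jacobiSol α l n := by
  obtain ⟨m, rfl⟩ := Nat.exists_eq_add_of_le' hn
  simp only [jacobiSol, Nat.add_sub_cancel]
  push_cast
  ring

theorem continuous_jacobiSol (α : ℝ) (n : ℕ) : Continuous fun l => jacobiSol α l n := by
  induction n using Nat.strong_induction_on with
  | _ n ih =>
    match n with
    | 0 => simpa only [jacobiSol] using continuous_const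
    | 1 => simpa only [jacobiSol] using continuous_const
    | n + 2 =>
      have h₁ := ih (n + 1) (by omega)
      have h₀ := ih n (by omega)
      simp only [jacobiSol]
      fun_prop

theorem padSeq_zero {N : ℕ} (w : Fin N → ℝ) : padSeq w 0 = 0 := by
  simp [padSeq]

theorem padSeq_of_lt {N : ℕ} (w : Fin N → ℝ) {n : ℕ} (h : N < n) : padSeq w n = 0 := by
  simp only [padSeq]
  rw [dif_neg (by omega)]

theorem padSeq_succ {N : ℕ} (w : Fin N → ℝ) (i : Fin N) : padSeq w (i + 1) = w i := by
  simp only [padSeq]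
  rw [dif_pos (by omega)]
  rfl

theorem sum_ite_eq_padSeq {N : ℕ} (w : Fin N → ℝ) (m : ℕ) :
    (∑ j : Fin N, if m = (j : ℕ) + 1 then w j else 0) = padSeq w m := by
  by_cases h : 1 ≤ m ∧ m ≤ N
  · obtain ⟨i, rfl⟩ : ∃ i : Fin N, m = i + 1 := ⟨⟨m - 1, by omega⟩, by simp; omega⟩
    rw [padSeq_succ]
    simp [← Fin.ext_iff]
  · simp only [padSeq]
    rw [dif_neg h]
    refine Finset.sum_eq_zero fun j _ => if_neg ?_
    omega

theorem hasSum_padSeq_sq {N : ℕ} (w : Fin N → ℝ) :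
    HasSum (fun n => padSeq w n ^ 2) (∑ i, w i ^ 2) := by
  have h : ∑ n ∈ Finset.range (N + 1), padSeq w n ^ 2 = ∑ i, w i ^ 2 := by
    rw [Finset.sum_range_succ', padSeq_zero,
      ← Fin.sum_univ_eq_sum_range (fun n => padSeq w (n + 1) ^ 2) N]
    simp [padSeq_succ]
  rw [← h]
  refine hasSum_sum_of_ne_finset_zero fun n hn => ?_
  rw [padSeq_of_lt w (by simpa using hn)]
  simp

theorem padSeq_recurrence {α l : ℝ} {N : ℕ} {w : Fin N → ℝ}
    (h : (Qmat α N).mulVec w = l • w) {n : ℕ} (hn : 1 ≤ n) (hnN : n ≤ N) :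
    (α * (n : ℝ) ^ 2 + 2) * padSeq w n - padSeq w (n - 1) - padSeq w (n + 1) =
      l * padSeq w n := by
  obtain ⟨i, rfl⟩ : ∃ i : Fin N, n = i + 1 := ⟨⟨n - 1, by omega⟩, by simp; omega⟩
  have hi := congrFun h i
  have hterm : ∀ j : Fin N, Qmat α N i j * w j =
      (α * ((i : ℕ) + 1 : ℝ) ^ 2 + 2) * (if (i : ℕ) + 1 = (j : ℕ) + 1 then w j else 0)
        - (if (i : ℕ) = (j : ℕ) + 1 then w j else 0)
        - (if (i : ℕ) + 1 + 1 = (j : ℕ) + 1 then w j else 0) := by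
    intro j
    simp only [Qmat]
    split_ifs <;> first | omega | simp
  simp only [Matrix.mulVec, dotProduct, hterm, Finset.sum_sub_distrib, ← Finset.mul_sum,
    sum_ite_eq_padSeq, Pi.smul_apply, smul_eq_mul] at hi
  rw [← padSeq_succ w i] at hi
  push_cast
  exact hi

theorem padSeq_eq_mul_jacobiSol {α l : ℝ} {N : ℕ} {w : Fin N → ℝ}
    (h : (Qmat α N).mulVec w = l • w) {n : ℕ} (hn : n ≤ N) :
    padSeq w n = padSeq w 1 * jacobiSol α l n := by
  induction n using Nat.strong_induction_on with
  | _ n ih =>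
    match n with
    | 0 => simp [padSeq_zero, jacobiSol]
    | 1 => simp [jacobiSol]
    | n + 2 =>
      have hr := padSeq_recurrence h (n := n + 1) (by omega) (by omega)
      rw [Nat.add_sub_cancel, ih (n + 1) (by omega) (by omega), ih n (by omega) (by omega)] at hr
      push_cast at hr
      simp only [jacobiSol]
      linear_combination -hr

theorem abs_padSeq_le_one {N : ℕ} {w : Fin N → ℝ} (hw : ∑ i, w i ^ 2 = 1) (n : ℕ) :
    |padSeq w n| ≤ 1 := by
  rw [← sq_le_one_iff_abs_le_one, ← hw]
  exact le_hasSum (hasSum_padSeq_sq w) n fun _ _ => sq_nonneg _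

/-- Unit eigenvectors of the truncations decay quadratically, uniformly in `N`. -/
theorem abs_padSeq_le {α l L : ℝ} (hα : 0 < α) (hl : |l| ≤ L) {N : ℕ} {w : Fin N → ℝ}
    (hw : ∑ i, w i ^ 2 = 1) (h : (Qmat α N).mulVec w = l • w) (n : ℕ) :
    |padSeq w n| ≤ (4 + L) / α / (n : ℝ) ^ 2 := by
  have hL : 0 ≤ L := (abs_nonneg l).trans hl
  rcases Nat.eq_zero_or_pos n with rfl | hn
  · simp [padSeq_zero]
  rcases lt_or_ge N n with hnN | hnN
  · rw [padSeq_of_lt w hnN, abs_zero]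
    positivity
  have hn' : (0 : ℝ) < n := by exact_mod_cast hn
  have hr := padSeq_recurrence h hn hnN
  have h₁ := abs_padSeq_le_one hw n
  rw [div_div, le_div_iff₀ (by positivity)]
  have key : α * (n : ℝ) ^ 2 * padSeq w n =
      padSeq w (n - 1) + padSeq w (n + 1) + (l - 2) * padSeq w n := by
    linear_combination hr
  have hl2 : |(l - 2) * padSeq w n| ≤ L + 2 := by
    rw [abs_mul]
    have : |l - 2| ≤ L + 2 := (abs_sub l 2).trans (by rw [abs_two]; linarith)
    nlinarith [abs_nonneg (l - 2), abs_nonneg (padSeq w n)]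
  calc |padSeq w n| * (α * (n : ℝ) ^ 2) = |α * (n : ℝ) ^ 2 * padSeq w n| := by
        rw [abs_mul, abs_of_nonneg (show 0 ≤ α * (n : ℝ) ^ 2 by positivity), mul_comm]
    _ ≤ |padSeq w (n - 1)| + |padSeq w (n + 1)| + |(l - 2) * padSeq w n| := by
        rw [key]
        exact abs_add_three _ _ _
    _ ≤ 4 + L := by
        linarith [abs_padSeq_le_one hw (n - 1), abs_padSeq_le_one hw (n + 1)]

theorem summable_const_div_sq_sq (K : ℝ) : Summable fun n : ℕ => (K / (n : ℝ) ^ 2) ^ 2 := by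
  have h := (Real.summable_one_div_nat_pow (p := 4)).2 (by norm_num)
  refine (h.mul_left (K ^ 2)).congr fun n => ?_
  rw [div_pow, ← pow_mul]
  ring

/-- convergence of eigenvectors of the truncations.  Fix `α > 0` and
`k ≥ 1`.  Let `μ N` list the eigenvalues of `Q_N` in nondecreasing order, let
`λ_k = lim_N λ_k(Q_N)`, and for each `N ≥ k` let `v N ∈ ℝ^N` be a unit eigenvector of `Q_N`
with eigenvalue `λ_k(Q_N)`.  Then there are signs `ξ N ∈ {-1, 1}` and a unit vector
`w ∈ ℓ²(ℕ)` such that `ξ N • (v N padded with zeros) → w` in `ℓ²(ℕ)` as `N → ∞`, and `w`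
is an eigenvector of the odd Jacobi operator `B_α^𝒪` with eigenvalue `λ_k`, i.e.
`(α n² + 2) wₙ - w_{n-1} - w_{n+1} = λ_k wₙ` for all `n ≥ 1` (with `w 0 = 0`). -/
theorem statement17 (α : ℝ) (hα : 0 < α) (k : ℕ) (hk : 1 ≤ k)
    (μ : (N : ℕ) → Fin N → ℝ) (hμ : ∀ N, IsEigSeq (Qmat α N) (μ N))
    (lam : ℝ) (hlam : Tendsto (fun N => eigAt μ k N) atTop (nhds lam))
    (v : (N : ℕ) → Fin N → ℝ)
    (hvunit : ∀ N, k ≤ N → ∑ i, v N i ^ 2 = 1)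
    (hveig : ∀ N, k ≤ N → (Qmat α N).mulVec (v N) = eigAt μ k N • v N) :
    ∃ (ξ : ℕ → ℝ) (w : ℕ → ℝ),
      (∀ N, ξ N = 1 ∨ ξ N = -1) ∧
      Summable (fun n => w n ^ 2) ∧ (∑' n : ℕ, w n ^ 2) = 1 ∧ w 0 = 0 ∧
      Tendsto (fun N => ∑' n : ℕ, (ξ N * padSeq (v N) n - w n) ^ 2) atTop (nhds 0) ∧
      ∀ n : ℕ, 1 ≤ n →
        (α * (n : ℝ) ^ 2 + 2) * w n - w (n - 1) - w (n + 1) = lam * w n := by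
  set l : ℕ → ℝ := fun N => eigAt μ k N with hldef
  set p : ℕ → ℝ := jacobiSol α lam with hp
  set c : ℕ → ℝ := fun N => |padSeq (v N) 1| with hc
  set ξ : ℕ → ℝ := fun N => if 0 ≤ padSeq (v N) 1 then 1 else -1 with hξ
  have hξ_cases : ∀ N, ξ N = 1 ∨ ξ N = -1 := fun N => by
    simp only [hξ]
    split_ifs <;> simp
  have hξ_mul : ∀ N, ξ N * padSeq (v N) 1 = c N := fun N => by
    simp only [hξ, hc]
    split_ifs with h
    · rw [one_mul, abs_of_nonneg h]
    · rw [neg_one_mul, abs_of_neg (not_le.1 h)]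
  have hξ_abs : ∀ N x, |ξ N * x| = |x| := fun N x => by
    rcases hξ_cases N with h | h <;> simp [h]
  set g : ℕ → ℝ := fun n => (4 + (|lam| + 1)) / α / (n : ℝ) ^ 2 with hg
  have hg_summable : Summable fun n => g n ^ 2 := summable_const_div_sq_sq _
  have hl_bound : ∀ᶠ N in atTop, |l N| ≤ |lam| + 1 :=
    (hlam.abs.eventually (gt_mem_nhds (lt_add_one |lam|))).mono fun _ h => h.le
  have hbound : ∀ᶠ N in atTop, ∀ n, |ξ N * padSeq (v N) n| ≤ g n := by
    filter_upwards [hl_bound, eventually_ge_atTop k] with N hN hkN n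
    rw [hξ_abs]
    exact abs_padSeq_le hα hN (hvunit N hkN) (hveig N hkN) n
  have hbound_sq : ∀ᶠ N in atTop, ∀ n, ‖(ξ N * padSeq (v N) n) ^ 2‖ ≤ g n ^ 2 := by
    filter_upwards [hbound] with N hN n
    rw [norm_pow, Real.norm_eq_abs]
    exact pow_le_pow_left₀ (abs_nonneg _) (hN n) 2
  have hsum_one : ∀ᶠ N in atTop, ∑' n, (ξ N * padSeq (v N) n) ^ 2 = 1 := by
    filter_upwards [eventually_ge_atTop k] with N hkN
    rw [← hvunit N hkN, ← (hasSum_padSeq_sq (v N)).tsum_eq]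
    exact tsum_congr fun n => by rw [← sq_abs, hξ_abs, sq_abs]
  have hform : ∀ n, ∀ᶠ N in atTop, c N * jacobiSol α (l N) n = ξ N * padSeq (v N) n := fun n => by
    filter_upwards [eventually_ge_atTop k, eventually_ge_atTop n] with N hkN hnN
    rw [padSeq_eq_mul_jacobiSol (hveig N hkN) hnN, ← hξ_mul, mul_assoc]
  have hpt : ∀ (U : Filter ℕ) (a : ℝ), U ≤ atTop → Tendsto c U (nhds a) → ∀ n,
      Tendsto (fun N => ξ N * padSeq (v N) n) U (nhds (a * p n)) := fun U a hU ha n =>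
    (ha.mul (((continuous_jacobiSol α n).tendsto lam).comp (hlam.mono_left hU))).congr'
      ((hform n).filter_mono hU)
  have hnormalized : ∀ (U : Filter ℕ) [U.NeBot] (a : ℝ), U ≤ atTop → Tendsto c U (nhds a) →
      ∑' n, (a * p n) ^ 2 = 1 := fun U _ a hU ha =>
    tendsto_nhds_unique
      (tendsto_tsum_of_dominated_convergence hg_summable (fun n => (hpt U a hU ha n).pow 2)
        (hbound_sq.filter_mono hU))
      (tendsto_const_nhds.congr' ((hsum_one.filter_mono hU).mono fun _ h => h.symm))
  have hc_mem : ∀ᶠ N in atTop, c N ∈ Set.Icc (0 : ℝ) 1 := by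
    filter_upwards [eventually_ge_atTop k] with N hkN
    exact ⟨abs_nonneg _, abs_padSeq_le_one (hvunit N hkN) 1⟩
  have hultra : ∀ U : Ultrafilter ℕ, ↑U ≤ (atTop : Filter ℕ) →
      Tendsto c U (nhds (Real.sqrt (∑' n, p n ^ 2)⁻¹)) := fun U hU => by
    obtain ⟨a, ha, hca⟩ := (isCompact_Icc (a := (0 : ℝ)) (b := 1)).ultrafilter_le_nhds
      (U.map c) (by
        rw [le_principal_iff]
        exact hU hc_mem)
    have hca' : Tendsto c U (nhds a) := hca
    have h₁ := hnormalized U a hU hca'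
    simp only [mul_pow, tsum_mul_left] at h₁
    rwa [← eq_inv_of_mul_eq_one_left h₁, Real.sqrt_sq ha.1]
  set a : ℝ := Real.sqrt (∑' n, p n ^ 2)⁻¹ with ha
  have hca : Tendsto c atTop (nhds a) := tendsto_iff_ultrafilter _ _ _ |>.2 hultra
  have hw_le : ∀ n, |a * p n| ≤ g n := fun n =>
    le_of_tendsto (hpt atTop a le_rfl hca n).abs (hbound.mono fun _ h => h n)
  refine ⟨ξ, fun n => a * p n, hξ_cases, ?_, hnormalized atTop a le_rfl hca, ?_, ?_, ?_⟩
  · refine hg_summable.of_nonneg_of_le (fun _ => sq_nonneg _) fun n => ?_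
    rw [← sq_abs]
    exact pow_le_pow_left₀ (abs_nonneg _) (hw_le n) 2
  · simp [hp, jacobiSol]
  · have hlim : ∀ n, Tendsto (fun N => (ξ N * padSeq (v N) n - a * p n) ^ 2) atTop (nhds 0) :=
      fun n => by simpa using ((hpt atTop a le_rfl hca n).sub_const (a * p n)).pow 2
    have hdom : ∀ᶠ N in atTop, ∀ n,
        ‖(ξ N * padSeq (v N) n - a * p n) ^ 2‖ ≤ 4 * g n ^ 2 := by
      filter_upwards [hbound] with N hN n
      rw [norm_pow, Real.norm_eq_abs, show 4 * g n ^ 2 = (g n + g n) ^ 2 by ring]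
      exact pow_le_pow_left₀ (abs_nonneg _)
        ((abs_sub _ _).trans (add_le_add (hN n) (hw_le n))) 2
    simpa using tendsto_tsum_of_dominated_convergence (hg_summable.mul_left 4) hlim hdom
  · intro n hn
    linear_combination a * jacobiSol_recurrence α lam hn
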